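/- arXiv:2301.13731 — 2 statements merged into one kernel-verified Lean document; each statement's English description precedes it below -/
import Mathlib

section
/- Let n ≥ 1, let f : ℝⁿ → ℝ be convex and differentiable with L_f-Lipschitz gradient, let M > 0 and let φ : ℝⁿ → ℝ be M-weakly convex. Let λ > 0, α ∈ (0,1), and τ > 0 with τ·α·λ·L_f ≤ 1. Let (q_k), (x_k), (y_k) be αPGD sequences for f, φ, λ, τ, α, and set F := λ·f + φ, δ := (α/(2τ))·(1 − 1/α)² and γ := (1/α)·(1/(2τ) − M·(2−α)/2). Then for every k ≥ 1, F(y_k) − F(y_{k+1}) ≥ −δ·‖y_k − y_{k−1}‖² + γ·‖y_{k+1} − y_k‖². -/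
open Set Filter Topology

section Descent

variable {E : Type*} [NormedAddCommGroup E] [InnerProductSpace ℝ E]

/-- Quadratic growth of a strongly convex function around a minimizer; `m` may be negative. -/
lemma StrongConvexOn.add_sq_le_of_isMinOn {s : Set E} {m : ℝ} {f : E → ℝ} {x y : E}
    (hf : StrongConvexOn s m f) (hmin : IsMinOn f s x) (hx : x ∈ s) (hy : y ∈ s) :
    f x + m / 2 * ‖x - y‖ ^ 2 ≤ f y := by
  have key : ∀ t ∈ Ioo (0 : ℝ) 1, f x + (1 - t) * (m / 2 * ‖x - y‖ ^ 2) ≤ f y := by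
    rintro t ⟨ht0, ht1⟩
    have hconv := hf.2 hx hy (sub_nonneg.2 ht1.le) ht0.le (sub_add_cancel 1 t)
    have hle := hmin (hf.1 hx hy (sub_nonneg.2 ht1.le) ht0.le (sub_add_cancel 1 t))
    simp only [mem_ofPred_eq, smul_eq_mul] at hconv hle
    refine le_of_mul_le_mul_left ?_ ht0
    linarith
  have hlim : Tendsto (fun t : ℝ => f x + (1 - t) * (m / 2 * ‖x - y‖ ^ 2)) (𝓝[>] 0)
      (𝓝 (f x + (1 - 0) * (m / 2 * ‖x - y‖ ^ 2))) :=
    (Continuous.tendsto (by fun_prop) 0).mono_left nhdsWithin_le_nhds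
  have hev : ∀ᶠ t in 𝓝[>] (0 : ℝ), f x + (1 - t) * (m / 2 * ‖x - y‖ ^ 2) ≤ f y := by
    filter_upwards [Ioo_mem_nhdsGT one_pos] with t ht using key t ht
  simpa using le_of_tendsto hlim hev

variable [CompleteSpace E]

lemma hasDerivAt_comp_add_smul_of_differentiable {f : E → ℝ} (hf : Differentiable ℝ f)
    (a v : E) (t : ℝ) :
    HasDerivAt (fun s : ℝ => f (a + s • v)) (inner ℝ (gradient f (a + t • v)) v) t := by
  have hline : HasDerivAt (fun s : ℝ => a + s • v) v t := by
    simpa using ((hasDerivAt_id t).smul_const v).const_add a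
  refine ((hf (a + t • v)).hasGradientAt.hasFDerivAt.comp_hasDerivAt t hline).congr_deriv ?_
  exact InnerProductSpace.toDual_apply_apply

/-- First-order characterization of convexity: the tangent plane lies below the graph. -/
lemma ConvexOn.add_inner_gradient_le {f : E → ℝ} (hfc : ConvexOn ℝ univ f)
    (hf : Differentiable ℝ f) (a b : E) :
    f a + inner ℝ (gradient f a) (b - a) ≤ f b := by
  have hline : ConvexOn ℝ univ (fun s : ℝ => f (a + s • (b - a))) := by
    have := hfc.comp_affineMap (AffineMap.lineMap a b : ℝ →ᵃ[ℝ] E)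
    simpa [Function.comp_def, AffineMap.lineMap_apply_module', add_comm] using this
  have h := hline.le_slope_of_hasDerivAt (mem_univ 0) (mem_univ 1) one_pos
    (hasDerivAt_comp_add_smul_of_differentiable hf a (b - a) 0)
  simp only [slope_def_field, zero_smul, one_smul, add_zero, add_sub_cancel, sub_zero,
    div_one] at h
  linarith

/-- The descent lemma for functions with Lipschitz gradient. -/
lemma le_add_inner_gradient_add_sq_of_lipschitz_gradient {f : E → ℝ} {L : ℝ}
    (hf : Differentiable ℝ f)
    (hLip : ∀ a b, ‖gradient f a - gradient f b‖ ≤ L * ‖a - b‖) (a b : E) :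
    f b ≤ f a + inner ℝ (gradient f a) (b - a) + L / 2 * ‖b - a‖ ^ 2 := by
  set v := b - a with hv
  have hderiv := hasDerivAt_comp_add_smul_of_differentiable hf a v
  have hbound : ∀ t : ℝ, HasDerivAt
      (fun s : ℝ => f a + s * inner ℝ (gradient f a) v + L / 2 * ‖v‖ ^ 2 * s ^ 2)
      (inner ℝ (gradient f a) v + L * t * ‖v‖ ^ 2) t := fun t => by
    refine ((((hasDerivAt_id t).mul_const (inner ℝ (gradient f a) v)).const_add (f a)).add
      ((hasDerivAt_pow 2 t).const_mul (L / 2 * ‖v‖ ^ 2))).congr_deriv ?_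
    simp
    ring
  have h := image_le_of_deriv_right_le_deriv_boundary (a := 0) (b := 1)
    (fun t _ => (hderiv t).continuousAt.continuousWithinAt)
    (fun t _ => (hderiv t).hasDerivWithinAt) (by simp)
    (fun t _ => (hbound t).continuousAt.continuousWithinAt)
    (fun t _ => (hbound t).hasDerivWithinAt)
    (fun t ht => by
      have hinner : inner ℝ (gradient f (a + t • v) - gradient f a) v ≤ L * t * ‖v‖ ^ 2 :=
        calc inner ℝ (gradient f (a + t • v) - gradient f a) v
            ≤ ‖gradient f (a + t • v) - gradient f a‖ * ‖v‖ := real_inner_le_norm _ _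
          _ ≤ L * ‖a + t • v - a‖ * ‖v‖ := by gcongr; exact hLip _ _
          _ = L * t * ‖v‖ ^ 2 := by
            rw [add_sub_cancel_left, norm_smul, Real.norm_of_nonneg ht.1]
            ring
      rw [inner_sub_left] at hinner
      linarith)
    (right_mem_Icc.2 zero_le_one)
  simpa [hv] using h

end Descent

/-- The three-point inequality for the proximal step of a function that is convex up to a
quadratic. -/
lemma prox_three_point_le {E : Type*} [NormedAddCommGroup E] [InnerProductSpace ℝ E]
    {φ : E → ℝ} {M τ : ℝ} {c z : E}
    (hφ : StrongConvexOn univ (-M) φ) (hτ : 0 ≤ τ)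
    (hz : IsMinOn (fun w => τ * φ w + (1 / 2) * ‖w - c‖ ^ 2) univ z) (w : E) :
    τ * φ z + (1 / 2) * ‖z - c‖ ^ 2 + (1 - τ * M) / 2 * ‖z - w‖ ^ 2 ≤
      τ * φ w + (1 / 2) * ‖w - c‖ ^ 2 := by
  refine StrongConvexOn.add_sq_le_of_isMinOn (f := fun w => τ * φ w + (1 / 2) * ‖w - c‖ ^ 2)
    ⟨convex_univ, fun u _ v _ a b ha hb hab => ?_⟩ hz (mem_univ _) (mem_univ _)
  have hconv := mul_le_mul_of_nonneg_left (hφ.2 (mem_univ u) (mem_univ v) ha hb hab) hτ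
  obtain rfl : b = 1 - a := by linarith
  have hc : a • u + (1 - a) • v - c = a • (u - c) + (1 - a) • (v - c) := by module
  have hsq : ‖a • u + (1 - a) • v - c‖ ^ 2 =
      a * ‖u - c‖ ^ 2 + (1 - a) * ‖v - c‖ ^ 2 - a * (1 - a) * ‖u - v‖ ^ 2 := by
    rw [hc, ← sub_sub_sub_cancel_right u v c]
    generalize u - c = p
    generalize v - c = r
    rw [norm_add_sq_real, norm_sub_sq_real, norm_smul, norm_smul, real_inner_smul_left,
      real_inner_smul_right, mul_pow, mul_pow, Real.norm_eq_abs, Real.norm_eq_abs, sq_abs, sq_abs]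
    ring
  simp only [smul_eq_mul] at hconv ⊢
  rw [hsq]
  linarith


/-- Per-iteration descent inequality for the αPGD algorithm:
`F(y_k) - F(y_{k+1}) ≥ -δ‖y_k - y_{k-1}‖² + γ‖y_{k+1} - y_k‖²` with
`δ = (α/(2τ))(1 - 1/α)²` and `γ = (1/α)(1/(2τ) - M(2-α)/2)`. -/
theorem alphaPGD_descent_inequality
    (n : ℕ) (hn : 1 ≤ n)
    (f φ : EuclideanSpace ℝ (Fin n) → ℝ) (Lf M lam α τ : ℝ)
    (hfc : ConvexOn ℝ Set.univ f)
    (hf : Differentiable ℝ f)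
    (hLip : ∀ a b, ‖gradient f a - gradient f b‖ ≤ Lf * ‖a - b‖)
    (hM : 0 < M)
    (hφ : ConvexOn ℝ Set.univ (fun w => φ w + (M / 2) * ‖w‖ ^ 2))
    (hlam : 0 < lam) (hα0 : 0 < α) (hα1 : α < 1)
    (hτ : 0 < τ) (hτle : τ * α * lam * Lf ≤ 1)
    (q x y : ℕ → EuclideanSpace ℝ (Fin n))
    (hy0 : y 0 = x 0)
    (hq : ∀ k, q (k + 1) = (1 - α) • y k + α • x k)
    (hx : ∀ k, IsMinOn
      (fun w => τ * φ w + (1 / 2) * ‖w - (x k - (τ * lam) • gradient f (q (k + 1)))‖ ^ 2)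
      Set.univ (x (k + 1)))
    (hy : ∀ k, y (k + 1) = (1 - α) • y k + α • x (k + 1)) :
    ∀ k : ℕ, 1 ≤ k →
      (lam * f (y k) + φ (y k)) - (lam * f (y (k + 1)) + φ (y (k + 1))) ≥
        -((α / (2 * τ)) * (1 - 1 / α) ^ 2) * ‖y k - y (k - 1)‖ ^ 2 +
          (1 / α) * (1 / (2 * τ) - M * (2 - α) / 2) * ‖y (k + 1) - y k‖ ^ 2 := by
  intro k hk
  obtain ⟨j, rfl⟩ := Nat.exists_eq_add_of_le' hk
  rw [Nat.add_sub_cancel]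
  have hφ' : StrongConvexOn univ (-M) φ := by
    rw [strongConvexOn_iff_convex]
    simpa only [neg_div, neg_mul, sub_neg_eq_add] using hφ
  set g := gradient f (q (j + 1 + 1)) with hg
  set d := x (j + 1 + 1) - y (j + 1) with hd
  set e := x (j + 1) - y (j + 1) with he
  have hstep : y (j + 1 + 1) - y (j + 1) = α • d := by rw [hy (j + 1)]; module
  have hstep' : y (j + 1 + 1) - q (j + 1 + 1) = α • (d - e) := by
    rw [hy (j + 1), hq (j + 1)]; module
  have hqy : y (j + 1) - q (j + 1 + 1) = -(α • e) := by rw [hq (j + 1)]; module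
  have hprev : e = (1 / α - 1) • (y (j + 1) - y j) := by
    rw [he, hy j]
    match_scalars <;> field_simp
    ring
  have hprox := prox_three_point_le hφ' hτ.le (hx (j + 1)) (y (j + 1))
  have hconv := hφ'.2 (mem_univ (y (j + 1))) (mem_univ (x (j + 1 + 1)))
    (sub_nonneg.2 hα1.le) hα0.le (sub_add_cancel 1 α)
  rw [← hy (j + 1), norm_sub_rev, ← hd] at hconv
  have htangent := hfc.add_inner_gradient_le hf (q (j + 1 + 1)) (y (j + 1))
  have hdescent := le_add_inner_gradient_add_sq_of_lipschitz_gradient hf hLip (q (j + 1 + 1))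
    (y (j + 1 + 1))
  rw [← hg, hqy, inner_neg_right, real_inner_smul_right] at htangent
  rw [← hg, hstep', real_inner_smul_right, inner_sub_right, norm_smul, mul_pow, Real.norm_eq_abs,
    sq_abs] at hdescent
  have hz : x (j + 1 + 1) - (x (j + 1) - (τ * lam) • g) = (d - e) + (τ * lam) • g := by
    rw [hd, he]; abel
  have hw : y (j + 1) - (x (j + 1) - (τ * lam) • g) = -e + (τ * lam) • g := by
    rw [he]; abel
  have hprox' : φ (x (j + 1 + 1)) ≤ φ (y (j + 1)) + (‖e‖ ^ 2 - ‖d - e‖ ^ 2) / (2 * τ)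
      - lam * inner ℝ g d - (1 / (2 * τ) - M / 2) * ‖d‖ ^ 2 := by
    rw [hz, hw, ← hd, norm_add_sq_real, norm_add_sq_real, norm_neg, inner_neg_left,
      inner_sub_left, real_inner_smul_right, real_inner_smul_right, real_inner_comm,
      real_inner_comm g e] at hprox
    refine le_of_mul_le_mul_left ?_ hτ
    field_simp
    linarith
  have hsmooth : lam * (Lf / 2 * (α ^ 2 * ‖d - e‖ ^ 2)) ≤ α / (2 * τ) * ‖d - e‖ ^ 2 := by
    rw [div_mul_eq_mul_div α, le_div_iff₀ (by positivity)]
    nlinarith [mul_le_mul_of_nonneg_right hτle (by positivity : 0 ≤ α * ‖d - e‖ ^ 2)]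
  have hE : ‖e‖ ^ 2 = (1 - 1 / α) ^ 2 * ‖y (j + 1) - y j‖ ^ 2 := by
    rw [hprev, norm_smul, mul_pow, Real.norm_eq_abs, sq_abs]
    ring
  have hD : ‖y (j + 1 + 1) - y (j + 1)‖ ^ 2 = α ^ 2 * ‖d‖ ^ 2 := by
    rw [hstep, norm_smul, mul_pow, Real.norm_eq_abs, sq_abs]
  have hf_le := mul_le_mul_of_nonneg_left (add_le_add htangent hdescent) hlam.le
  have hφ_le := mul_le_mul_of_nonneg_left hprox' hα0.le
  have hrhs : -((α / (2 * τ)) * (1 - 1 / α) ^ 2) * ‖y (j + 1) - y j‖ ^ 2 +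
      (1 / α) * (1 / (2 * τ) - M * (2 - α) / 2) * ‖y (j + 1 + 1) - y (j + 1)‖ ^ 2 =
      -(α / (2 * τ)) * ‖e‖ ^ 2 + α * (1 / (2 * τ) - M * (2 - α) / 2) * ‖d‖ ^ 2 := by
    rw [hE, hD]
    field_simp
  rw [hrhs]
  simp only [smul_eq_mul] at hconv
  ring_nf at hconv hφ_le hf_le hsmooth ⊢
  linarith
end

section
/- Let n ≥ 1, let f : ℝⁿ → ℝ be convex and differentiable with L_f-Lipschitz gradient, and let α ∈ (0,1]. Let q, y, y⁺ ∈ ℝⁿ and set x⁺ := (1/α)·y⁺ + (1 − 1/α)·y. Then f(q) + ⟨∇f(q), x⁺ − q⟩ ≥ (1/α)·(f(y⁺) − (L_f/2)·‖y⁺ − q‖²) + (1 − 1/α)·f(y). -/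
open scoped RealInnerProductSpace

section

variable {E : Type*} [NormedAddCommGroup E] [InnerProductSpace ℝ E] [CompleteSpace E] {f : E → ℝ}

theorem HasGradientAt.hasDerivAt_comp_lineMap {g x y : E} {t : ℝ}
    (hf : HasGradientAt f g (AffineMap.lineMap x y t)) :
    HasDerivAt (f ∘ AffineMap.lineMap (k := ℝ) x y) ⟪g, y - x⟫ t := by
  simpa using hf.hasFDerivAt.comp_hasDerivAt t AffineMap.hasDerivAt_lineMap

/-- The first-order characterization of convexity: the graph lies above its tangents. -/
theorem ConvexOn.add_inner_gradient_le_s16 {s : Set E} (hfc : ConvexOn ℝ s f) {x y g : E}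
    (hx : x ∈ s) (hy : y ∈ s) (hf : HasGradientAt f g x) : f x + ⟪g, y - x⟫ ≤ f y := by
  have hderiv : HasDerivAt (f ∘ AffineMap.lineMap (k := ℝ) x y) ⟪g, y - x⟫ 0 :=
    HasGradientAt.hasDerivAt_comp_lineMap (by simpa using hf)
  have hslope := (hfc.comp_affineMap (AffineMap.lineMap x y)).le_slope_of_hasDerivAt
    (by simpa using hx) (by simpa using hy) zero_lt_one hderiv
  simp only [slope_def_field, Function.comp_apply, AffineMap.lineMap_apply_zero,
    AffineMap.lineMap_apply_one] at hslope
  linarith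

/-- The descent lemma: a function with `L`-Lipschitz gradient lies below its quadratic
upper model. -/
theorem Differentiable.le_add_inner_gradient_add_sq (hf : Differentiable ℝ f) {L : ℝ}
    (hLip : ∀ a b, ‖gradient f a - gradient f b‖ ≤ L * ‖a - b‖) (x y : E) :
    f y ≤ f x + ⟪gradient f x, y - x⟫ + L / 2 * ‖y - x‖ ^ 2 := by
  have hderiv (t : ℝ) : HasDerivAt
      (fun s : ℝ => f (AffineMap.lineMap x y s) -
        (s * ⟪gradient f x, y - x⟫ + L / 2 * ‖y - x‖ ^ 2 * s ^ 2))
      (⟪gradient f (AffineMap.lineMap x y t), y - x⟫ -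
        (⟪gradient f x, y - x⟫ + L * ‖y - x‖ ^ 2 * t)) t := by
    refine ((hf _).hasGradientAt.hasDerivAt_comp_lineMap.sub
      (((hasDerivAt_id t).mul_const ⟪gradient f x, y - x⟫).add
        ((hasDerivAt_pow 2 t).const_mul (L / 2 * ‖y - x‖ ^ 2)))).congr_deriv ?_
    norm_num
    ring
  have hanti := antitoneOn_of_hasDerivWithinAt_nonpos (convex_Icc (0 : ℝ) 1)
    (fun t _ => (hderiv t).continuousAt.continuousWithinAt)
    (fun t _ => (hderiv t).hasDerivWithinAt) fun t ht => by
      rw [interior_Icc] at ht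
      have hgrad : ‖gradient f (AffineMap.lineMap x y t) - gradient f x‖ ≤
          L * (t * ‖y - x‖) := by
        simpa [AffineMap.lineMap_apply, norm_smul, abs_of_pos ht.1] using
          hLip (AffineMap.lineMap x y t) x
      have hinner := (real_inner_le_norm (gradient f (AffineMap.lineMap x y t) - gradient f x)
        (y - x)).trans (mul_le_mul_of_nonneg_right hgrad (norm_nonneg _))
      rw [inner_sub_left] at hinner
      linarith
  have hle := hanti (Set.left_mem_Icc.2 zero_le_one) (Set.right_mem_Icc.2 zero_le_one) zero_le_one
  simp only [AffineMap.lineMap_apply_zero, AffineMap.lineMap_apply_one] at hle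
  linarith

end

/-- Combination of the descent lemma and convexity of `f` along the relaxed
update: with `x⁺ = (1/α) y⁺ + (1 - 1/α) y`,
`f(q) + ⟨∇f(q), x⁺ - q⟩ ≥ (1/α)(f(y⁺) - (L_f/2)‖y⁺ - q‖²) + (1 - 1/α) f(y)`. -/
theorem descent_convexity_combination
    (n : ℕ) (hn : 1 ≤ n)
    (f : EuclideanSpace ℝ (Fin n) → ℝ) (Lf α : ℝ)
    (hfc : ConvexOn ℝ Set.univ f)
    (hf : Differentiable ℝ f)
    (hLip : ∀ a b, ‖gradient f a - gradient f b‖ ≤ Lf * ‖a - b‖)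
    (hα0 : 0 < α) (hα1 : α ≤ 1)
    (q y yp : EuclideanSpace ℝ (Fin n)) :
    f q + ⟪gradient f q, ((1 / α) • yp + (1 - 1 / α) • y) - q⟫ ≥
      (1 / α) * (f yp - (Lf / 2) * ‖yp - q‖ ^ 2) + (1 - 1 / α) * f y := by
  have hdescent := hf.le_add_inner_gradient_add_sq hLip q yp
  have hconvex := hfc.add_inner_gradient_le_s16 (Set.mem_univ q) (Set.mem_univ y) (hf q).hasGradientAt
  have hsplit : ((1 / α) • yp + (1 - 1 / α) • y) - q =
      (1 / α) • (yp - q) + (1 - 1 / α) • (y - q) := by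
    module
  rw [hsplit, inner_add_right, real_inner_smul_right, real_inner_smul_right]
  have hinv : 1 ≤ 1 / α := (one_le_div hα0).2 hα1
  nlinarith [mul_le_mul_of_nonneg_left hdescent (zero_le_one.trans hinv),
    mul_le_mul_of_nonneg_left hconvex (sub_nonneg.2 hinv)]
end
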